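/- (Weighted stability) Fix q₀ > 0 and M > 0. There exists C > 0, depending only on n, Ω, A, q₀ and M, with the following property. Let q, q̃ : closure(Ω) → ℝ be Lipschitz with q ≥ q₀, q̃ ≥ q₀, ‖q‖_{W^{1,∞}} ≤ M, ‖q̃‖_{W^{1,∞}} ≤ M and q = q̃ on ∂Ω. Let u, ũ ∈ C²(Ω) ∩ C¹(closure(Ω)) be classical solutions of L_q u = 0 and L_{q̃} ũ = 0 with u = ũ on ∂Ω, ‖u‖_{C¹(closure(Ω))} ≤ M and ‖ũ‖_{C¹(closure(Ω))} ≤ M. Set √I_q := √q·|u| and √I_{q̃} := √q̃·|ũ| (Lipschitz functions on closure(Ω)). Then ‖√I_q · (q − q̃)‖_{H¹(Ω)} ≤ C ‖√I_q − √I_{q̃}‖_{H¹(Ω)}^{1/2}. -/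

import Mathlib

open MeasureTheory Metric Set
open scoped RealInnerProductSpace

noncomputable section

/-- The `i`-th partial derivative of a real-valued function on `ℝⁿ`. -/
noncomputable def pd {n : ℕ} (i : Fin n) (f : EuclideanSpace ℝ (Fin n) → ℝ)
    (x : EuclideanSpace ℝ (Fin n)) : ℝ :=
  fderiv ℝ f x (EuclideanSpace.single i 1)

/-- `u` is a classical solution of `L_q u = ∑ᵢⱼ ∂ᵢ (aⁱʲ ∂ⱼ u) + q u = 0` pointwise in `Ω`. -/
def IsSolution {n : ℕ} (A : Fin n → Fin n → EuclideanSpace ℝ (Fin n) → ℝ)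
    (q u : EuclideanSpace ℝ (Fin n) → ℝ) (Ω : Set (EuclideanSpace ℝ (Fin n))) : Prop :=
  ∀ x ∈ Ω, (∑ i, ∑ j, pd i (fun y => A i j y * pd j u y) x) + q x * u x = 0

/-- The `H¹(D)` norm `(∫_D (w² + ‖∇w‖²))^{1/2}`. -/
noncomputable def H1Norm {n : ℕ} (D : Set (EuclideanSpace ℝ (Fin n)))
    (w : EuclideanSpace ℝ (Fin n) → ℝ) : ℝ :=
  (∫ x in D, ((w x) ^ 2 + ‖fderiv ℝ w x‖ ^ 2)) ^ (1 / 2 : ℝ)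

/-- `A = (aⁱʲ)` is symmetric, has `C¹` entries on `closure Ω`, and is uniformly elliptic. -/
def EllipticSym {n : ℕ} (Ω : Set (EuclideanSpace ℝ (Fin n)))
    (A : Fin n → Fin n → EuclideanSpace ℝ (Fin n) → ℝ) : Prop :=
  (∀ i j, ∀ x ∈ closure Ω, A i j x = A j i x) ∧
  (∀ i j, ContDiffOn ℝ 1 (A i j) (closure Ω)) ∧
  (∃ lam > 0, ∀ x ∈ Ω, ∀ ξ : EuclideanSpace ℝ (Fin n),
    lam * ‖ξ‖ ^ 2 ≤ ∑ i, ∑ j, A i j x * ξ i * ξ j)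

/-- `‖f‖_{W^{1,∞}(closure Ω)} = sup |f| + Lip(f) ≤ M`. -/
def W1InfBound {n : ℕ} (Ω : Set (EuclideanSpace ℝ (Fin n)))
    (f : EuclideanSpace ℝ (Fin n) → ℝ) (M : ℝ) : Prop :=
  ∃ K : NNReal, LipschitzOnWith K f (closure Ω) ∧ ∀ x ∈ closure Ω, |f x| + (K : ℝ) ≤ M

/-- `∂Ω` is of class `C^{1,1}`: near each boundary point, after choosing a direction `ν`,
`Ω` is the region on one side of the graph of a function with Lipschitz derivative. -/
def IsC11Boundary {n : ℕ} (Ω : Set (EuclideanSpace ℝ (Fin n))) : Prop :=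
  ∀ x ∈ frontier Ω, ∃ r > 0, ∃ ν : EuclideanSpace ℝ (Fin n), ‖ν‖ = 1 ∧
    ∃ φ : EuclideanSpace ℝ (Fin n) → ℝ, ∃ K : NNReal,
      Differentiable ℝ φ ∧ LipschitzWith K (fderiv ℝ φ) ∧
      ∀ y ∈ ball x r, (y ∈ Ω ↔ ⟪y, ν⟫ < φ (y - ⟪y, ν⟫ • ν))

lemma scalar_ibp {n : ℕ} {Ω : Set (EuclideanSpace ℝ (Fin n))} (hΩ : IsOpen Ω)
    {F g : EuclideanSpace ℝ (Fin n) → ℝ} (hF : ContDiffOn ℝ 1 F Ω) {K : NNReal}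
    (hg : LipschitzWith K g) (hgc : HasCompactSupport g) (hgs : tsupport g ⊆ Ω)
    (v : EuclideanSpace ℝ (Fin n)) :
    IntegrableOn (fun x => fderiv ℝ F x v * g x) Ω ∧
    IntegrableOn (fun x => F x * fderiv ℝ g x v) Ω ∧
    ∫ x in Ω, fderiv ℝ F x v * g x = - ∫ x in Ω, F x * fderiv ℝ g x v := by
  obtain ⟨L, hLc, hL1, hL2⟩ := exists_compact_between hgc hΩ hgs
  obtain ⟨χ, hχ1, hχ0, -⟩ := exists_contMDiffMap_one_nhds_of_subset_interior
    (n := 1) (modelWithCornersSelf ℝ (EuclideanSpace ℝ (Fin n))) (isClosed_tsupport g) hL1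
  have hχd : ContDiff ℝ 1 (fun x => χ x) := χ.contMDiff.contDiff
  set f : EuclideanSpace ℝ (Fin n) → ℝ := fun x => χ x * F x with hf
  have hχs : tsupport (fun x => χ x) ⊆ L := by
    apply closure_minimal _ hLc.isClosed
    intro x hx
    by_contra h
    exact hx (hχ0 x h)
  have hfs : tsupport f ⊆ L := by
    apply closure_minimal _ hLc.isClosed
    intro x hx
    by_contra h
    exact hx (by simp [hf, hχ0 x h])
  have hfc : HasCompactSupport f := hLc.of_isClosed_subset (isClosed_tsupport f) hfs
  have hfd : ContDiff ℝ 1 f := by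
    rw [contDiff_iff_contDiffAt]
    intro x
    by_cases hx : x ∈ Ω
    · exact hχd.contDiffAt.mul (hF.contDiffAt (hΩ.mem_nhds hx))
    · have : f =ᶠ[nhds x] fun _ => 0 := by
        have : x ∉ tsupport f := fun h => hx (hL2 (hfs h))
        exact notMem_tsupport_iff_eventuallyEq.1 this
      exact contDiffAt_const.congr_of_eventuallyEq this
  have hfF : ∀ x ∈ tsupport g, f =ᶠ[nhds x] F := by
    intro x hx
    have := (Filter.Eventually.filter_mono (nhds_le_nhdsSet hx) hχ1)
    filter_upwards [this] with y hy
    simp [hf, hy]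
  obtain ⟨C, hfl⟩ := ContDiff.lipschitzWith_of_hasCompactSupport hfc hfd (by simp)
  have key := hfl.integral_lineDeriv_mul_eq (μ := volume) hg hgc v
  have e1 : ∀ x, lineDeriv ℝ f x v * g x = fderiv ℝ F x v * g x := by
    intro x
    by_cases hx : x ∈ tsupport g
    · rw [((hfd.differentiable (by simp)) x).lineDeriv_eq_fderiv, (hfF x hx).fderiv_eq]
    · simp [image_eq_zero_of_notMem_tsupport hx]
  have e1' : ∀ x, fderiv ℝ f x v * g x = fderiv ℝ F x v * g x := by
    intro x
    rw [← e1, ((hfd.differentiable (by simp)) x).lineDeriv_eq_fderiv]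
  have e2 : ∀ x, fderiv ℝ g x v * f x = F x * fderiv ℝ g x v := by
    intro x
    by_cases hx : x ∈ tsupport g
    · rw [(hfF x hx).eq_of_nhds, mul_comm]
    · simp [fderiv_of_notMem_tsupport ℝ hx]
  have e3 : (fun x => lineDeriv ℝ g x (-v) * f x) =ᵐ[volume] fun x => - (F x * fderiv ℝ g x v) := by
    filter_upwards [hg.ae_differentiableAt] with x hx
    rw [hx.lineDeriv_eq_fderiv, ← e2]
    simp
  have i1 : Integrable (fun x => fderiv ℝ F x v * g x) := by
    have : Continuous (fun x => fderiv ℝ f x v * g x) :=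
      ((hfd.continuous_fderiv (by simp)).clm_apply continuous_const).mul hg.continuous
    rw [show (fun x => fderiv ℝ F x v * g x) = (fun x => fderiv ℝ f x v * g x) from
      funext fun x => (e1' x).symm]
    exact this.integrable_of_hasCompactSupport hgc.mul_left
  have i2 : Integrable (fun x => F x * fderiv ℝ g x v) := by
    rw [show (fun x => F x * fderiv ℝ g x v) = (fun x => fderiv ℝ g x v * f x) from
      funext fun x => (e2 x).symm]
    have hfi : Integrable f := hfd.continuous.integrable_of_hasCompactSupport hfc
    refine hfi.bdd_mul (c := K * ‖v‖) (measurable_fderiv_apply_const ℝ g v).aestronglyMeasurable ?_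
    refine Filter.Eventually.of_forall fun x => ?_
    exact (ContinuousLinearMap.le_opNorm _ _).trans
      (mul_le_mul_of_nonneg_right (norm_fderiv_le_of_lipschitz ℝ hg) (norm_nonneg _))
  refine ⟨i1.integrableOn, i2.integrableOn, ?_⟩
  rw [setIntegral_eq_integral_of_forall_compl_eq_zero,
    setIntegral_eq_integral_of_forall_compl_eq_zero, ← integral_neg, ← integral_congr_ae e3, ← key]
  · simp only [e1]
  · intro x hx
    rw [fderiv_of_notMem_tsupport ℝ (fun h => hx (hgs h))]; simp
  · intro x hx
    rw [image_eq_zero_of_notMem_tsupport (fun h => hx (hgs h))]; simp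

/-- Truncations of a Lipschitz function vanishing on the boundary. -/
lemma exists_trunc {n : ℕ} (hn : n = 2 ∨ n = 3) {Ω : Set (EuclideanSpace ℝ (Fin n))}
    (hΩ : IsOpen Ω) (hΩb : Bornology.IsBounded Ω) {θ : EuclideanSpace ℝ (Fin n) → ℝ} {K : NNReal}
    (hθ : LipschitzOnWith K θ (closure Ω)) (hθ0 : ∀ x ∈ frontier Ω, θ x = 0) :
    ∃ g : ℕ → EuclideanSpace ℝ (Fin n) → ℝ,
      (∀ k, LipschitzWith (2 * K) (g k)) ∧ (∀ k, HasCompactSupport (g k)) ∧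
      (∀ k, tsupport (g k) ⊆ Ω) ∧ (∀ k, ∀ x ∈ Ω, |g k x| ≤ |θ x|) ∧
      (∀ x ∈ Ω, ∀ᶠ k in Filter.atTop, g k =ᶠ[nhds x] θ) := by
  have : Nontrivial (EuclideanSpace ℝ (Fin n)) := by
    have : Nonempty (Fin n) := ⟨⟨0, by omega⟩⟩
    infer_instance
  obtain ⟨Θ, hΘ, hΘe⟩ := hθ.extend_real
  have huniv : Ω ≠ univ := by
    rintro rfl
    exact NormedSpace.unbounded_univ ℝ _ hΩb
  have hne : (Ωᶜ).Nonempty := by rwa [nonempty_compl]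
  set δ : EuclideanSpace ℝ (Fin n) → ℝ := fun x => infDist x Ωᶜ with hδ
  have hδl : LipschitzWith 1 δ := lipschitz_infDist_pt _
  have hbd : ∀ x ∈ Ω, |θ x| ≤ K * δ x := by
    intro x hx
    obtain ⟨y, hy, hxy⟩ := exists_mem_frontier_infDist_compl_eq_dist hx huniv
    have := hθ.dist_le_mul x (subset_closure hx) y (frontier_subset_closure hy)
    rw [hθ0 y hy, Real.dist_eq, sub_zero] at this
    simpa [hδ, hxy] using this
  -- the barrier
  set β : ℕ → EuclideanSpace ℝ (Fin n) → ℝ :=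
    fun k x => 2 * K * max (δ x - 1 / (k + 1 : ℝ)) 0 with hβ
  have hβ0 : ∀ k x, 0 ≤ β k x := fun k x => by positivity
  have hβl : ∀ k, LipschitzWith (2 * K) (β k) := by
    intro k
    apply LipschitzWith.of_dist_le_mul
    intro x y
    have h1 := hδl.dist_le_mul x y
    rw [Real.dist_eq] at h1 ⊢
    have h2 : |max (δ x - 1 / (k + 1 : ℝ)) 0 - max (δ y - 1 / (k + 1 : ℝ)) 0| ≤ |δ x - δ y| := by
      refine (abs_max_sub_max_le_abs _ _ _).trans (le_of_eq ?_)
      congr 1; ring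
    simp only [hβ, ← mul_sub, abs_mul]
    push_cast at h1 ⊢
    rw [abs_of_nonneg (K.coe_nonneg), abs_of_pos (by norm_num : (0:ℝ) < 2)]
    exact mul_le_mul_of_nonneg_left (by linarith) (by positivity)
  have hΘl : LipschitzWith (2 * K) Θ := hΘ.weaken (by
    rw [two_mul]; exact le_add_of_nonneg_left (zero_le))
  refine ⟨fun k x => max (-β k x) (min (Θ x) (β k x)), ?_, ?_, ?_, ?_, ?_⟩
  · intro k
    have := (hβl k).neg.max (hΘl.min (hβl k))
    simpa using this
  all_goals
    have hcl : ∀ k : ℕ, IsClosed {x | 1 / (k + 1 : ℝ) ≤ δ x} := fun k =>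
      isClosed_le continuous_const hδl.continuous
    have hsub : ∀ k : ℕ, {x | 1 / (k + 1 : ℝ) ≤ δ x} ⊆ Ω := by
      intro k x hx
      by_contra h
      have h0 : δ x = 0 := infDist_zero_of_mem h
      have : (0:ℝ) < 1 / (k + 1 : ℝ) := by positivity
      simp only [mem_ofPred_eq, h0] at hx
      linarith
    have hts : ∀ k : ℕ, tsupport (fun x => max (-β k x) (min (Θ x) (β k x))) ⊆
        {x | 1 / (k + 1 : ℝ) ≤ δ x} := by
      intro k
      apply closure_minimal _ (hcl k)
      intro x hx
      by_contra h
      simp only [mem_ofPred_eq, not_le] at h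
      apply hx
      have : β k x = 0 := by
        simp only [hβ]
        rw [max_eq_right (by linarith)]; simp
      simp [this]
  · intro k
    refine IsCompact.of_isClosed_subset ?_ (isClosed_tsupport _) (hts k)
    exact Metric.isCompact_of_isClosed_isBounded (hcl k) (hΩb.subset (hsub k))
  · intro k
    exact (hts k).trans (hsub k)
  · intro k x hx
    have := hβ0 k x
    rw [hΘe (subset_closure hx)]
    show |max (-β k x) (min (Θ x) (β k x))| ≤ |Θ x|
    rcases le_total (Θ x) (β k x) with h | h
    · rw [min_eq_left h]
      rcases le_total (-β k x) (Θ x) with h' | h'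
      · rw [max_eq_right h']
      · rw [max_eq_left h', abs_neg, abs_of_nonneg this]
        rw [abs_of_nonpos (by linarith)]; linarith
    · rw [min_eq_right h, max_eq_right (by linarith), abs_of_nonneg this]
      exact h.trans (le_abs_self _)
  · intro x hx
    have hpos : 0 < δ x := (hΩ.isClosed_compl.notMem_iff_infDist_pos hne).1 (by simpa using hx)
    obtain ⟨N, hN⟩ := exists_nat_one_div_lt (show 0 < δ x / 2 by linarith)
    filter_upwards [Filter.eventually_ge_atTop N] with k hk
    have hk' : 1 / (k + 1 : ℝ) < δ x / 2 := by
      refine lt_of_le_of_lt ?_ hN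
      have : (N : ℝ) ≤ k := by exact_mod_cast hk
      exact one_div_le_one_div_of_le (by positivity) (by linarith)
    have ho : ∀ᶠ y in nhds x, 1 / (k + 1 : ℝ) < δ y / 2 :=
      (hδl.continuous.div_const 2).continuousAt.eventually_const_lt hk'
    filter_upwards [ho, hΩ.mem_nhds hx] with y hy hyΩ
    have h1 := hbd y hyΩ
    have h2 : |θ y| ≤ β k y := by
      refine h1.trans ?_
      have h3 : δ y / 2 ≤ max (δ y - 1 / (k + 1 : ℝ)) 0 := le_max_of_le_left (by linarith)
      have h4 := mul_le_mul_of_nonneg_left h3 (show (0:ℝ) ≤ 2 * K by positivity)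
      simp only [hβ]
      linarith
    rw [abs_le] at h2
    show max (-β k y) (min (Θ y) (β k y)) = θ y
    rw [← hΘe (subset_closure hyΩ), min_eq_left h2.2, max_eq_right h2.1]

/-- The bilinear form `(p, r) ↦ ∑ᵢⱼ aⁱʲ(x) pⱼ rᵢ` on covectors. -/
def bil {n : ℕ} (A : Fin n → Fin n → EuclideanSpace ℝ (Fin n) → ℝ)
    (x : EuclideanSpace ℝ (Fin n)) :
    (EuclideanSpace ℝ (Fin n) →L[ℝ] ℝ) →ₗ[ℝ] (EuclideanSpace ℝ (Fin n) →L[ℝ] ℝ) →ₗ[ℝ] ℝ :=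
  LinearMap.mk₂ ℝ
    (fun p r => ∑ i, ∑ j, A i j x * p (EuclideanSpace.single j 1) * r (EuclideanSpace.single i 1))
    (fun p p' r => by
      simp only [← Finset.sum_add_distrib]
      refine Finset.sum_congr rfl fun i _ => Finset.sum_congr rfl fun j _ => ?_
      simp; ring)
    (fun c p r => by
      simp only [Finset.smul_sum]
      refine Finset.sum_congr rfl fun i _ => Finset.sum_congr rfl fun j _ => ?_
      simp; ring)
    (fun p r r' => by
      simp only [← Finset.sum_add_distrib]
      refine Finset.sum_congr rfl fun i _ => Finset.sum_congr rfl fun j _ => ?_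
      simp; ring)
    (fun c p r => by
      simp only [Finset.smul_sum]
      refine Finset.sum_congr rfl fun i _ => Finset.sum_congr rfl fun j _ => ?_
      simp; ring)

lemma bil_apply {n : ℕ} (A : Fin n → Fin n → EuclideanSpace ℝ (Fin n) → ℝ)
    (x : EuclideanSpace ℝ (Fin n)) (p r : EuclideanSpace ℝ (Fin n) →L[ℝ] ℝ) :
    bil A x p r =
    ∑ i, ∑ j, A i j x * p (EuclideanSpace.single j 1) * r (EuclideanSpace.single i 1) := rfl

lemma bil_bound {n : ℕ} {A : Fin n → Fin n → EuclideanSpace ℝ (Fin n) → ℝ}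
    {x : EuclideanSpace ℝ (Fin n)} {N : ℝ} (hN : ∀ i j, |A i j x| ≤ N)
    (p r : EuclideanSpace ℝ (Fin n) →L[ℝ] ℝ) :
    |bil A x p r| ≤ (n * n * N) * ‖p‖ * ‖r‖ := by
  rw [bil_apply]
  have h1 : ∀ (p : EuclideanSpace ℝ (Fin n) →L[ℝ] ℝ) i, |p (EuclideanSpace.single i 1)| ≤ ‖p‖ := by
    intro p i
    simpa using p.le_opNorm (EuclideanSpace.single i 1)
  calc |∑ i, ∑ j, A i j x * p (EuclideanSpace.single j 1) * r (EuclideanSpace.single i 1)|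
      ≤ ∑ i, ∑ j, |A i j x * p (EuclideanSpace.single j 1) * r (EuclideanSpace.single i 1)| :=
        (Finset.abs_sum_le_sum_abs _ _).trans
          (Finset.sum_le_sum fun i _ => Finset.abs_sum_le_sum_abs _ _)
    _ ≤ ∑ _i : Fin n, ∑ _j : Fin n, N * ‖p‖ * ‖r‖ := by
        refine Finset.sum_le_sum fun i _ => Finset.sum_le_sum fun j _ => ?_
        rw [abs_mul, abs_mul]
        have h0 : 0 ≤ N := (abs_nonneg _).trans (hN i j)
        exact mul_le_mul (mul_le_mul (hN i j) (h1 p j) (abs_nonneg _) h0) (h1 r i) (abs_nonneg _)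
          (by positivity)
    _ = _ := by simp; ring

lemma bil_coercive {n : ℕ} {A : Fin n → Fin n → EuclideanSpace ℝ (Fin n) → ℝ}
    {x : EuclideanSpace ℝ (Fin n)} {lam : ℝ}
    (h : ∀ ξ : EuclideanSpace ℝ (Fin n), lam * ‖ξ‖ ^ 2 ≤ ∑ i, ∑ j, A i j x * ξ i * ξ j)
    (p : EuclideanSpace ℝ (Fin n) →L[ℝ] ℝ) :
    lam * ‖p‖ ^ 2 ≤ bil A x p p := by
  obtain ⟨ξ, rfl⟩ := (InnerProductSpace.toDual ℝ (EuclideanSpace ℝ (Fin n))).surjective p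
  have := h ξ
  rw [LinearIsometryEquiv.norm_map]
  refine this.trans (le_of_eq ?_)
  rw [bil_apply]
  refine Finset.sum_congr rfl fun i _ => Finset.sum_congr rfl fun j _ => ?_
  simp [InnerProductSpace.toDual_apply_apply, EuclideanSpace.inner_single_right]
  ring

lemma weak_compact {n : ℕ} {Ω : Set (EuclideanSpace ℝ (Fin n))} (hΩ : IsOpen Ω)
    {A : Fin n → Fin n → EuclideanSpace ℝ (Fin n) → ℝ} (hA : ∀ i j, ContDiffOn ℝ 1 (A i j) Ω)
    {q u g : EuclideanSpace ℝ (Fin n) → ℝ} (hu : ContDiffOn ℝ 2 u Ω) (hs : IsSolution A q u Ω)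
    {K : NNReal}
    (hg : LipschitzWith K g) (hgc : HasCompactSupport g) (hgs : tsupport g ⊆ Ω) :
    IntegrableOn (fun x => g x * bil A x (fderiv ℝ u x) (fderiv ℝ u x)
      + u x * bil A x (fderiv ℝ u x) (fderiv ℝ g x) - q x * (u x) ^ 2 * g x) Ω ∧
    ∫ x in Ω, (g x * bil A x (fderiv ℝ u x) (fderiv ℝ u x)
      + u x * bil A x (fderiv ℝ u x) (fderiv ℝ g x) - q x * (u x) ^ 2 * g x) = 0 := by
  have hpd : ∀ j, ContDiffOn ℝ 1 (pd j u) Ω := by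
    intro j
    have : ContDiffOn ℝ 1 (fderiv ℝ u) Ω := hu.fderiv_of_isOpen hΩ (by norm_num)
    exact this.clm_apply contDiffOn_const
  have hG : ∀ i j, ContDiffOn ℝ 1 (fun y => A i j y * pd j u y) Ω := fun i j =>
    (hA i j).mul (hpd j)
  have hu1 : ContDiffOn ℝ 1 u Ω := hu.of_le (by norm_num)
  have hF : ∀ i j, ContDiffOn ℝ 1 (fun y => u y * (A i j y * pd j u y)) Ω := fun i j =>
    hu1.mul (hG i j)
  have H := fun i j => scalar_ibp hΩ (hF i j) hg hgc hgs (EuclideanSpace.single i 1)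
  have e : EqOn (fun x => g x * bil A x (fderiv ℝ u x) (fderiv ℝ u x)
      + u x * bil A x (fderiv ℝ u x) (fderiv ℝ g x) - q x * (u x) ^ 2 * g x)
      (fun x => ∑ i, ∑ j, (fderiv ℝ (fun y => u y * (A i j y * pd j u y)) x
        (EuclideanSpace.single i 1) * g x + u x * (A i j x * pd j u x) *
          fderiv ℝ g x (EuclideanSpace.single i 1))) Ω := by
    intro x hx
    have hux : DifferentiableAt ℝ u x :=
      (hu1.contDiffAt (hΩ.mem_nhds hx)).differentiableAt (by simp)
    have hGx : ∀ i j, DifferentiableAt ℝ (fun y => A i j y * pd j u y) x := fun i j =>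
      ((hG i j).contDiffAt (hΩ.mem_nhds hx)).differentiableAt (by simp)
    have hsx := hs x hx
    have e1 : ∀ i j, fderiv ℝ (fun y => u y * (A i j y * pd j u y)) x (EuclideanSpace.single i 1)
        = u x * pd i (fun y => A i j y * pd j u y) x + A i j x * pd j u x * pd i u x := by
      intro i j
      rw [fderiv_fun_mul hux (hGx i j)]
      simp [pd]
    simp only [e1, bil_apply]
    have e2 : q x * u x ^ 2 * g x =
        -(u x * g x * ∑ i, ∑ j, pd i (fun y => A i j y * pd j u y) x) := by
      linear_combination (u x * g x) * hsx
    rw [e2, sub_neg_eq_add]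
    simp only [Finset.mul_sum, ← Finset.sum_add_distrib]
    refine Finset.sum_congr rfl fun i _ => Finset.sum_congr rfl fun j _ => ?_
    simp only [pd]
    ring
  have hi : ∀ i j, IntegrableOn (fun x => fderiv ℝ (fun y => u y * (A i j y * pd j u y)) x
        (EuclideanSpace.single i 1) * g x + u x * (A i j x * pd j u x) *
          fderiv ℝ g x (EuclideanSpace.single i 1)) Ω := fun i j => (H i j).1.add (H i j).2.1
  have hz : ∀ i j, ∫ x in Ω, (fderiv ℝ (fun y => u y * (A i j y * pd j u y)) x
        (EuclideanSpace.single i 1) * g x + u x * (A i j x * pd j u x) *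
          fderiv ℝ g x (EuclideanSpace.single i 1)) = 0 := fun i j => by
    rw [integral_add (H i j).1 (H i j).2.1, (H i j).2.2]; simp
  constructor
  · refine (integrableOn_congr_fun e hΩ.measurableSet).2 ?_
    exact integrable_finsetSum _ fun i _ => integrable_finsetSum _ fun j _ => hi i j
  · rw [setIntegral_congr_fun hΩ.measurableSet e, integral_finsetSum]
    · refine Finset.sum_eq_zero fun i _ => ?_
      rw [integral_finsetSum _ fun j _ => hi i j]
      exact Finset.sum_eq_zero fun j _ => hz i j
    · exact fun i _ => integrable_finsetSum _ fun j _ => hi i j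

lemma weak_form {n : ℕ} (hn : n = 2 ∨ n = 3) {Ω : Set (EuclideanSpace ℝ (Fin n))}
    (hΩ : IsOpen Ω) (hΩb : Bornology.IsBounded Ω)
    {A : Fin n → Fin n → EuclideanSpace ℝ (Fin n) → ℝ} (hA : ∀ i j, ContDiffOn ℝ 1 (A i j) Ω)
    {N M : ℝ} (hN : ∀ i j, ∀ x ∈ Ω, |A i j x| ≤ N) (hN0 : 0 ≤ N) (hM0 : 0 ≤ M)
    {q u θ : EuclideanSpace ℝ (Fin n) → ℝ} (hu : ContDiffOn ℝ 2 u Ω) (hs : IsSolution A q u Ω)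
    (huM : ∀ x ∈ Ω, |u x| ≤ M) (hduM : ∀ x ∈ Ω, ‖fderiv ℝ u x‖ ≤ M)
    (hqM : ∀ x ∈ Ω, |q x| ≤ M) {K : NNReal}
    (hθ : LipschitzOnWith K θ (closure Ω)) (hθ0 : ∀ x ∈ frontier Ω, θ x = 0) :
    IntegrableOn (fun x => θ x * bil A x (fderiv ℝ u x) (fderiv ℝ u x)
      + u x * bil A x (fderiv ℝ u x) (fderiv ℝ θ x) - q x * (u x) ^ 2 * θ x) Ω ∧
    ∫ x in Ω, (θ x * bil A x (fderiv ℝ u x) (fderiv ℝ u x)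
      + u x * bil A x (fderiv ℝ u x) (fderiv ℝ θ x) - q x * (u x) ^ 2 * θ x) = 0 := by
  obtain ⟨g, g1, g2, g3, g4, g5⟩ := exists_trunc hn hΩ hΩb hθ hθ0
  obtain ⟨T, hT⟩ := (hΩb.isCompact_closure).exists_bound_of_continuousOn hθ.continuousOn
  have hT' : ∀ x ∈ Ω, |θ x| ≤ |T| := fun x hx => (hT x (subset_closure hx)).trans (le_abs_self _)
  have H := fun k => weak_compact hΩ hA hu hs (g1 k) (g2 k) (g3 k)
  set I : ℕ → EuclideanSpace ℝ (Fin n) → ℝ := fun k x =>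
    g k x * bil A x (fderiv ℝ u x) (fderiv ℝ u x)
      + u x * bil A x (fderiv ℝ u x) (fderiv ℝ (g k) x) - q x * (u x) ^ 2 * g k x with hI
  set I₀ : EuclideanSpace ℝ (Fin n) → ℝ := fun x =>
    θ x * bil A x (fderiv ℝ u x) (fderiv ℝ u x)
      + u x * bil A x (fderiv ℝ u x) (fderiv ℝ θ x) - q x * (u x) ^ 2 * θ x with hI₀
  have hev : ∀ x ∈ Ω, ∀ᶠ k in Filter.atTop, I k x = I₀ x := by
    intro x hx
    filter_upwards [g5 x hx] with k hk
    simp only [hI, hI₀, hk.fderiv_eq, hk.eq_of_nhds]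
  set Bd : ℝ := |T| * ((n * n * N) * M * M) + M * ((n * n * N) * M * (2 * K)) + M * M ^ 2 * |T|
  have hbd : ∀ k, ∀ x ∈ Ω, ‖I k x‖ ≤ Bd := by
    intro k x hx
    have hb := bil_bound (fun i j => hN i j x hx)
    have hgx := (g4 k x hx).trans (hT' x hx)
    have hdg : ‖fderiv ℝ (g k) x‖ ≤ 2 * K := by
      simpa using norm_fderiv_le_of_lipschitz ℝ (g1 k) (x₀ := x)
    have hux := huM x hx
    have hdux := hduM x hx
    have hqx := hqM x hx
    rw [Real.norm_eq_abs]
    refine (abs_sub _ _).trans (add_le_add ((abs_add_le _ _).trans (add_le_add ?_ ?_)) ?_)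
    · rw [abs_mul]
      refine mul_le_mul hgx ((hb _ _).trans ?_) (abs_nonneg _) (abs_nonneg _)
      gcongr
    · rw [abs_mul]
      refine mul_le_mul hux ((hb _ _).trans ?_) (abs_nonneg _) hM0
      gcongr
    · rw [abs_mul, abs_mul, abs_pow]
      gcongr
  have hbd0 : ∀ x ∈ Ω, ‖I₀ x‖ ≤ Bd := by
    intro x hx
    obtain ⟨k, hk⟩ := (hev x hx).exists
    rw [← hk]; exact hbd k x hx
  have hfin : volume Ω < ⊤ := hΩb.measure_lt_top
  have hlim : ∀ᵐ x ∂(volume.restrict Ω), Filter.Tendsto (fun k => I k x) Filter.atTop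
      (nhds (I₀ x)) := by
    refine (ae_restrict_iff' hΩ.measurableSet).2 (Filter.Eventually.of_forall fun x hx => ?_)
    exact (tendsto_const_nhds).congr' ((hev x hx).mono fun k hk => hk.symm)
  have hmeas : AEStronglyMeasurable I₀ (volume.restrict Ω) :=
    aestronglyMeasurable_of_tendsto_ae Filter.atTop (fun k => (H k).1.aestronglyMeasurable) hlim
  have hc : IntegrableOn (fun _ : EuclideanSpace ℝ (Fin n) => Bd) Ω :=
    integrableOn_const hfin.ne
  refine ⟨hc.mono' hmeas ((ae_restrict_iff' hΩ.measurableSet).2 (Filter.Eventually.of_forall hbd0)),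
    ?_⟩
  have hten := tendsto_integral_of_dominated_convergence (fun _ => Bd)
    (fun k => (H k).1.aestronglyMeasurable) hc
    (fun k => (ae_restrict_iff' hΩ.measurableSet).2 (Filter.Eventually.of_forall (hbd k))) hlim
  refine tendsto_nhds_unique hten ?_
  have : (fun k => ∫ x in Ω, I k x) = fun _ => 0 := funext fun k => (H k).2
  rw [this]
  exact tendsto_const_nhds

set_option maxHeartbeats 2000000 in
lemma pointwise_est {F : Type*} [NormedAddCommGroup F] [NormedSpace ℝ F] {m N lam : ℝ}
    (hm : 0 < m) (hN : 0 < N) (hlam : 0 < lam) :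
    ∃ Ca Cb : ℝ, 0 ≤ Ca ∧ 0 ≤ Cb ∧ ∀ (B : F →ₗ[ℝ] F →ₗ[ℝ] ℝ) (a b w wt : ℝ) (P Pt a' b' : F),
      (∀ p r, |B p r| ≤ N * ‖p‖ * ‖r‖) → (∀ p, lam * ‖p‖ ^ 2 ≤ B p p) →
      m ≤ a → m ≤ b → a ≤ N → b ≤ N → 0 ≤ w → w ≤ N → 0 ≤ wt → wt ≤ N →
      ‖P‖ ≤ N → ‖Pt‖ ≤ N → ‖a'‖ ≤ N → ‖b'‖ ≤ N →
      |a * w - b * wt| + ‖(w • a' + a • P) - (wt • b' + b • Pt)‖ ≤ 6 * N ^ 2 ∧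
      (a * w * (a ^ 2 - b ^ 2)) ^ 2 +
        ‖(a ^ 2 - b ^ 2) • (w • a' + a • P) + (a * w) • ((2 * a) • a' - (2 * b) • b')‖ ^ 2 ≤
      Ca * (((1 - a / b) * B P P + w * B P (-(1 / b) • a' + (a / b ^ 2) • b')
          - a ^ 2 * w ^ 2 * (1 - a / b)) +
        ((1 - b / a) * B Pt Pt + wt * B Pt (-(1 / a) • b' + (b / a ^ 2) • a')
          - b ^ 2 * wt ^ 2 * (1 - b / a))) +
      Cb * (|a * w - b * wt| + ‖(w • a' + a • P) - (wt • b' + b • Pt)‖) := by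
  set C1 : ℝ := 2 * N ^ 2 * (N / m + 1) + 2 * (N ^ 2 * (1 / m + N / m ^ 2)) with hC1
  set C2 : ℝ := 2 * N ^ 2 * (1 + N + N / m) + 4 * N ^ 2 with hC2
  set C4 : ℝ := 1 / lam + N / m with hC4
  refine ⟨6 * C2 ^ 2 * C4, 6 * C2 ^ 2 * (6 * N ^ 2 + C4 * C1), by positivity, by positivity, ?_⟩
  intro B a b w wt P Pt a' b' hB hBc hma hmb haN hbN hw hwN hwt hwtN hP hPt ha' hb'
  have ha : 0 < a := hm.trans_le hma
  have hb : 0 < b := hm.trans_le hmb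
  set d : ℝ := a * w - b * wt with hd
  set d' : F := (w • a' + a • P) - (wt • b' + b • Pt) with hd'
  set z : ℝ := w * (a - b) with hz
  set X : ℝ := |d| + ‖d'‖ with hX
  have hX0 : 0 ≤ X := by positivity
  have hdX : |d| ≤ X := by simp [hX]
  have hd'X : ‖d'‖ ≤ X := by simp [hX]
  have hXle : X ≤ 6 * N ^ 2 := by
    have h1 : |d| ≤ 2 * N ^ 2 := by
      have e1 : a * w ≤ N * N := mul_le_mul haN hwN hw hN.le
      have e2 : b * wt ≤ N * N := mul_le_mul hbN hwtN hwt hN.le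
      have e3 : 0 ≤ a * w := by positivity
      have e4 : 0 ≤ b * wt := by positivity
      rw [abs_le]; constructor <;> nlinarith
    have h2 : ‖d'‖ ≤ 4 * N ^ 2 := by
      have k : ∀ (s : ℝ) (p : F), 0 ≤ s → s ≤ N → ‖p‖ ≤ N → ‖s • p‖ ≤ N ^ 2 := by
        intro s p hs hsN hp
        rw [norm_smul, Real.norm_of_nonneg hs, sq]
        exact mul_le_mul hsN hp (norm_nonneg _) hN.le
      have := k w a' hw hwN ha'
      have := k a P ha.le haN hP
      have := k wt b' hwt hwtN hb'
      have := k b Pt hb.le hbN hPt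
      have := norm_sub_le (w • a' + a • P) (wt • b' + b • Pt)
      have := norm_add_le (w • a') (a • P)
      have := norm_add_le (wt • b') (b • Pt)
      linarith
    linarith
  refine ⟨hXle, ?_⟩
  set rest : ℝ := d * (a * w + b * wt) * (b / a - 1)
    + B P ((1 / b) • d' - (d / b ^ 2) • b') - B Pt ((1 / a) • d' - (d / a ^ 2) • a') with hrest
  set I : ℝ := (((1 - a / b) * B P P + w * B P (-(1 / b) • a' + (a / b ^ 2) • b')
          - a ^ 2 * w ^ 2 * (1 - a / b)) +
        ((1 - b / a) * B Pt Pt + wt * B Pt (-(1 / a) • b' + (b / a ^ 2) • a')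
          - b ^ 2 * wt ^ 2 * (1 - b / a))) with hI
  have hid : B (P - Pt) (P - Pt) + a * w ^ 2 * (a - b) ^ 2 / b = I + rest := by
    simp only [hI, hrest, hd', hd, map_sub, map_add, map_smul, LinearMap.sub_apply, smul_eq_mul,
      map_neg, neg_smul]
    field_simp
    ring
  have hrb : rest ≤ C1 * X := by
    have h1 : d * (a * w + b * wt) * (b / a - 1) ≤ 2 * N ^ 2 * (N / m + 1) * X := by
      refine (le_abs_self _).trans ?_
      rw [abs_mul, abs_mul]
      have e1 : |a * w + b * wt| ≤ 2 * N ^ 2 := by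
        rw [abs_of_nonneg (by positivity)]
        have e1 : a * w ≤ N * N := mul_le_mul haN hwN hw hN.le
        have e2 : b * wt ≤ N * N := mul_le_mul hbN hwtN hwt hN.le
        nlinarith
      have e2 : |b / a - 1| ≤ N / m + 1 := by
        refine (abs_sub _ _).trans ?_
        rw [abs_one, abs_of_pos (by positivity)]
        gcongr
      calc |d| * |a * w + b * wt| * |b / a - 1| ≤ X * (2 * N ^ 2) * (N / m + 1) := by gcongr
        _ = _ := by ring
    have h2 : ∀ (c : ℝ) (p c' : F), m ≤ c → ‖p‖ ≤ N → ‖c'‖ ≤ N →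
        |B p ((1 / c) • d' - (d / c ^ 2) • c')| ≤ N ^ 2 * (1 / m + N / m ^ 2) * X := by
      intro c p c' hc hp hc'
      have hc0 : 0 < c := hm.trans_le hc
      have e1 : ‖(1 / c) • d' - (d / c ^ 2) • c'‖ ≤ (1 / m + N / m ^ 2) * X := by
        refine (norm_sub_le _ _).trans ?_
        rw [norm_smul, norm_smul, Real.norm_eq_abs, Real.norm_eq_abs, abs_div, abs_div,
          abs_one, abs_of_pos hc0, abs_of_pos (by positivity : 0 < c ^ 2)]
        calc 1 / c * ‖d'‖ + |d| / c ^ 2 * ‖c'‖ ≤ 1 / m * X + X / m ^ 2 * N := by gcongr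
          _ = _ := by ring
      calc _ ≤ N * ‖p‖ * ‖(1 / c) • d' - (d / c ^ 2) • c'‖ := hB _ _
        _ ≤ N * N * ((1 / m + N / m ^ 2) * X) := by gcongr
        _ = _ := by ring
    have h3 := (abs_le.1 (h2 b P b' hmb hP hb')).2
    have h4 := (abs_le.1 (h2 a Pt a' hma hPt ha')).1
    have : C1 * X = 2 * N ^ 2 * (N / m + 1) * X + N ^ 2 * (1 / m + N / m ^ 2) * X
      + N ^ 2 * (1 / m + N / m ^ 2) * X := by rw [hC1]; ring
    rw [this]
    linarith
  set Y : ℝ := X + ‖P - Pt‖ + |z| with hY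
  have hφ0 : 0 ≤ ‖P - Pt‖ := norm_nonneg _
  have hz0 : 0 ≤ |z| := abs_nonneg _
  have hY0 : 0 ≤ Y := by positivity
  have hv : |a * w * (a ^ 2 - b ^ 2)| ≤ C2 * Y := by
    have e : a * w * (a ^ 2 - b ^ 2) = a * (a + b) * z := by rw [hz]; ring
    rw [e, abs_mul, abs_of_pos (by positivity)]
    have h1 : a * (a + b) ≤ N * (N + N) := by gcongr
    have h2 : N * (N + N) ≤ C2 := by
      have : 0 ≤ 2 * N ^ 2 * (N + N / m) + 4 * N ^ 2 := by positivity
      rw [hC2]; nlinarith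
    have h3 : |z| ≤ Y := by rw [hY]; linarith
    have h4 : 0 ≤ C2 := by positivity
    exact mul_le_mul (h1.trans h2) h3 hz0 h4
  have hv' : ‖(a ^ 2 - b ^ 2) • (w • a' + a • P) + (a * w) • ((2 * a) • a' - (2 * b) • b')‖
      ≤ C2 * Y := by
    set z' : F := d' - b • (P - Pt) - (w - wt) • b' with hz'
    have e : (a ^ 2 - b ^ 2) • (w • a' + a • P) + (a * w) • ((2 * a) • a' - (2 * b) • b')
        = (a * (a + b)) • z' + z • ((2 * a) • a' + a • b' + b • a') := by
      rw [hz', hd', hz]; module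
    have hφ : |w - wt| ≤ (|d| + |z|) / m := by
      rw [le_div_iff₀ hm]
      have : b * (w - wt) = d - z := by rw [hd, hz]; ring
      calc |w - wt| * m ≤ |w - wt| * b := by gcongr
        _ = |d - z| := by rw [← this, abs_mul, abs_of_pos hb, mul_comm]
        _ ≤ _ := abs_sub _ _
    have hz'b : ‖z'‖ ≤ (1 + N + N / m) * Y := by
      have h1 : ‖z'‖ ≤ ‖d'‖ + ‖b • (P - Pt)‖ + ‖(w - wt) • b'‖ :=
        (norm_sub_le _ _).trans (by gcongr; exact norm_sub_le _ _)
      have h2 : ‖b • (P - Pt)‖ ≤ N * Y := by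
        rw [norm_smul, Real.norm_of_nonneg hb.le]
        have : ‖P - Pt‖ ≤ Y := by rw [hY]; linarith
        gcongr
      have h3 : ‖(w - wt) • b'‖ ≤ N / m * Y := by
        rw [norm_smul, Real.norm_eq_abs]
        have : |d| + |z| ≤ Y := by rw [hY]; linarith
        calc |w - wt| * ‖b'‖ ≤ Y / m * N := by
              refine mul_le_mul (hφ.trans (by gcongr)) hb' (norm_nonneg _) (by positivity)
          _ = _ := by ring
      have h4 : ‖d'‖ ≤ Y := by rw [hY]; linarith
      calc _ ≤ Y + N * Y + N / m * Y := by linarith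
        _ = _ := by ring
    have hc' : ‖(2 * a) • a' + a • b' + b • a'‖ ≤ 4 * N ^ 2 := by
      refine (norm_add₃_le).trans ?_
      rw [norm_smul, norm_smul, norm_smul, Real.norm_of_nonneg ha.le, Real.norm_of_nonneg hb.le,
        Real.norm_of_nonneg (by positivity)]
      calc 2 * a * ‖a'‖ + a * ‖b'‖ + b * ‖a'‖ ≤ 2 * N * N + N * N + N * N := by gcongr
        _ = _ := by ring
    rw [e]
    refine (norm_add_le _ _).trans ?_
    rw [norm_smul, norm_smul, Real.norm_of_nonneg (by positivity), Real.norm_eq_abs]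
    have h3 : |z| ≤ Y := by rw [hY]; linarith
    calc a * (a + b) * ‖z'‖ + |z| * ‖(2 * a) • a' + a • b' + b • a'‖
        ≤ N * (N + N) * ((1 + N + N / m) * Y) + Y * (4 * N ^ 2) := by gcongr
      _ = C2 * Y := by rw [hC2]; ring
  have hsq : (a * w * (a ^ 2 - b ^ 2)) ^ 2 +
        ‖(a ^ 2 - b ^ 2) • (w • a' + a • P) + (a * w) • ((2 * a) • a' - (2 * b) • b')‖ ^ 2
        ≤ 2 * C2 ^ 2 * Y ^ 2 := by
    have h1 := pow_le_pow_left₀ (abs_nonneg _) hv 2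
    have h2 := pow_le_pow_left₀ (norm_nonneg _) hv' 2
    rw [sq_abs] at h1
    rw [mul_pow] at h1 h2
    linarith
  have hY2 : Y ^ 2 ≤ 3 * (X ^ 2 + (‖P - Pt‖ ^ 2 + z ^ 2)) := by
    rw [← sq_abs z, hY]
    nlinarith [sq_nonneg (X - ‖P - Pt‖), sq_nonneg (X - |z|), sq_nonneg (‖P - Pt‖ - |z|)]
  have hX2 : X ^ 2 ≤ 6 * N ^ 2 * X := by
    rw [sq]; exact mul_le_mul_of_nonneg_right hXle hX0
  have hQ : ‖P - Pt‖ ^ 2 + z ^ 2 ≤ C4 * (I + rest) := by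
    rw [← hid]
    set Q := a * w ^ 2 * (a - b) ^ 2 / b with hQd
    have hQ0 : 0 ≤ Q := by positivity
    have hBP := hBc (P - Pt)
    have hB0 : 0 ≤ B (P - Pt) (P - Pt) := le_trans (by positivity) hBP
    have h1 : ‖P - Pt‖ ^ 2 ≤ 1 / lam * B (P - Pt) (P - Pt) := by
      rw [one_div, inv_mul_eq_div, le_div_iff₀ hlam]; linarith
    have h2 : z ^ 2 ≤ N / m * Q := by
      have : z ^ 2 = b / a * Q := by rw [hz, hQd]; field_simp
      rw [this]
      gcongr
    have h3 : 0 ≤ 1 / lam * Q := by positivity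
    have h4 : 0 ≤ N / m * B (P - Pt) (P - Pt) := by positivity
    rw [hC4]
    have h5 : (1 / lam + N / m) * (B (P - Pt) (P - Pt) + Q) = 1 / lam * B (P - Pt) (P - Pt)
      + 1 / lam * Q + N / m * B (P - Pt) (P - Pt) + N / m * Q := by ring
    rw [h5]
    linarith
  have hC40 : 0 ≤ C4 := by positivity
  have hfin : Y ^ 2 ≤ 3 * (6 * N ^ 2 * X + C4 * I + C4 * (C1 * X)) := by
    have h1 := mul_le_mul_of_nonneg_left hrb hC40
    have h2 : C4 * (I + rest) = C4 * I + C4 * rest := mul_add _ _ _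
    rw [h2] at hQ
    linarith
  calc _ ≤ 2 * C2 ^ 2 * Y ^ 2 := hsq
    _ ≤ 2 * C2 ^ 2 * (3 * (6 * N ^ 2 * X + C4 * I + C4 * (C1 * X))) := by gcongr
    _ = _ := by ring

lemma fderiv_abs_cases {E : Type*} [NormedAddCommGroup E] [NormedSpace ℝ E] {u : E → ℝ} {x : E}
    (hu : DifferentiableAt ℝ u x) (ha : DifferentiableAt ℝ (fun y => |u y|) x) :
    ∃ s : ℝ, s * s = 1 ∧ |u x| = s * u x ∧
      fderiv ℝ (fun y => |u y|) x = s • fderiv ℝ u x := by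
  rcases lt_trichotomy (u x) 0 with h | h | h
  · refine ⟨-1, by norm_num, by rw [abs_of_neg h]; ring, ?_⟩
    have : (fun y => |u y|) =ᶠ[nhds x] fun y => - u y := by
      filter_upwards [hu.continuousAt.eventually_lt_const h] with y hy
      exact abs_of_neg hy
    rw [this.fderiv_eq, fderiv_fun_neg]; simp
  · refine ⟨1, by norm_num, by simp [h], ?_⟩
    have h0 : fderiv ℝ (fun y => |u y|) x = 0 := by
      apply IsLocalMin.fderiv_eq_zero
      exact Filter.Eventually.of_forall fun y => by simp [h]
    have h1 := ha.hasFDerivAt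
    rw [h0] at h1 ⊢
    have h2 : HasFDerivAt u (0 : E →L[ℝ] ℝ) x := by
      rw [hasFDerivAt_iff_isLittleO] at h1 ⊢
      simp only [h, abs_zero, sub_zero, zero_apply] at h1 ⊢
      exact (Asymptotics.isLittleO_abs_left).1 h1
    rw [h2.fderiv]; simp
  · refine ⟨1, by norm_num, by rw [abs_of_pos h]; ring, ?_⟩
    have : (fun y => |u y|) =ᶠ[nhds x] u := by
      filter_upwards [hu.continuousAt.eventually_const_lt h] with y hy
      exact abs_of_pos hy
    rw [this.fderiv_eq]; simp

lemma ae_diff_of_locally {n : ℕ} {Ω : Set (EuclideanSpace ℝ (Fin n))} (hΩ : IsOpen Ω)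
    {f : EuclideanSpace ℝ (Fin n) → ℝ}
    (hf : ∀ x ∈ Ω, ∃ K : NNReal, ∃ t ∈ nhds x, LipschitzOnWith K f t) :
    ∀ᵐ x ∂(volume.restrict Ω), DifferentiableAt ℝ f x := by
  rw [ae_restrict_iff' hΩ.measurableSet]
  have : volume {x | x ∈ Ω ∧ ¬ DifferentiableAt ℝ f x} = 0 := by
    apply measure_null_of_locally_null
    rintro x ⟨hx, -⟩
    obtain ⟨K, t, ht, hK⟩ := hf x hx
    refine ⟨{x | x ∈ Ω ∧ ¬ DifferentiableAt ℝ f x} ∩ interior t, ?_, ?_⟩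
    · exact inter_mem_nhdsWithin _ (interior_mem_nhds.2 ht)
    · have h := hK.ae_differentiableWithinAt_of_mem (μ := volume)
      refine measure_mono_null ?_ h
      rintro y ⟨⟨-, hy⟩, hyt⟩ hcon
      exact hy ((hcon (interior_subset hyt)).differentiableAt (mem_interior_iff_mem_nhds.1 hyt))
  refine measure_mono_null ?_ this
  intro x hx
  simpa using hx

lemma fderiv_formulas {E : Type*} [NormedAddCommGroup E] [NormedSpace ℝ E]
    {q qt w wt : E → ℝ} {x : E} {q' qt' P Pt : E →L[ℝ] ℝ}
    (hq : HasFDerivAt q q' x) (hqt : HasFDerivAt qt qt' x)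
    (hw : HasFDerivAt w P x) (hwt : HasFDerivAt wt Pt x) (hq0 : 0 < q x) (hqt0 : 0 < qt x)
    {a b : ℝ} {a' b' : E →L[ℝ] ℝ} (ha : a = √(q x)) (hb : b = √(qt x))
    (ha' : a' = (1 / (2 * a)) • q') (hb' : b' = (1 / (2 * b)) • qt') :
    fderiv ℝ (fun y => √(q y) * w y * (q y - qt y)) x =
      (a ^ 2 - b ^ 2) • (w x • a' + a • P) + (a * w x) • ((2 * a) • a' - (2 * b) • b') ∧
    fderiv ℝ (fun y => √(q y) * w y - √(qt y) * wt y) x =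
      (w x • a' + a • P) - (wt x • b' + b • Pt) ∧
    fderiv ℝ (fun y => 1 - √(q y) / √(qt y)) x = -(1 / b) • a' + (a / b ^ 2) • b' := by
  have hapos : 0 < a := by rw [ha]; exact Real.sqrt_pos.2 hq0
  have hbpos : 0 < b := by rw [hb]; exact Real.sqrt_pos.2 hqt0
  have hsa : HasFDerivAt (fun y => √(q y)) a' x := by
    have := hq.sqrt hq0.ne'
    rw [← ha, ← ha'] at this; exact this
  have hsb : HasFDerivAt (fun y => √(qt y)) b' x := by
    have := hqt.sqrt hqt0.ne'
    rw [← hb, ← hb'] at this; exact this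
  have hqa : q x = a ^ 2 := by rw [ha, Real.sq_sqrt hq0.le]
  have hqb : qt x = b ^ 2 := by rw [hb, Real.sq_sqrt hqt0.le]
  have hq'a : q' = (2 * a) • a' := by rw [ha', smul_smul]; field_simp; simp
  have hq'b : qt' = (2 * b) • b' := by rw [hb', smul_smul]; field_simp; simp
  refine ⟨?_, ?_, ?_⟩
  · have h := (hsa.mul hw).mul (hq.sub hqt)
    have h := h.fderiv
    refine Eq.trans ?_ (h.trans ?_)
    · rfl
    · simp only [Pi.mul_apply, Pi.sub_apply]
      rw [← ha, hqa, hqb, hq'a, hq'b]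
      module
  · have h := ((hsa.mul hw).sub (hsb.mul hwt)).fderiv
    refine Eq.trans ?_ (h.trans ?_)
    · rfl
    · rw [← ha, ← hb]
      module
  · have hinv : HasFDerivAt (fun y => (√(qt y))⁻¹) (-(b ^ 2)⁻¹ • b') x := by
      have h1 : HasDerivAt (fun t : ℝ => t⁻¹) (-(b ^ 2)⁻¹) (√(qt x)) := by
        rw [← hb]; exact hasDerivAt_inv hbpos.ne'
      exact h1.comp_hasFDerivAt x hsb
    have h := ((hsa.mul hinv).const_sub 1).fderiv
    refine Eq.trans ?_ (h.trans ?_)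
    · rfl
    · rw [← ha, ← hb]
      simp only [div_eq_mul_inv]
      module

lemma theta_lip {E : Type*} [PseudoMetricSpace E] {S : Set E} {q qt : E → ℝ} {K₁ K₂ : NNReal}
    {q₀ M : ℝ} (hq₀ : 0 < q₀)
    (h1 : LipschitzOnWith K₁ q S) (h2 : LipschitzOnWith K₂ qt S)
    (hq : ∀ x ∈ S, q₀ ≤ q x) (hqt : ∀ x ∈ S, q₀ ≤ qt x) (hqM : ∀ x ∈ S, q x ≤ M) :
    ∃ K : NNReal, LipschitzOnWith K (fun x => 1 - √(q x) / √(qt x)) S := by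
  set m := √q₀ with hm
  have hm0 : 0 < m := Real.sqrt_pos.2 hq₀
  have sl : ∀ s t : ℝ, q₀ ≤ s → q₀ ≤ t → |√s - √t| ≤ |s - t| / m := by
    intro s t hs ht
    have e1 : s - t = (√s - √t) * (√s + √t) := by
      have := Real.sq_sqrt (hq₀.le.trans hs)
      have := Real.sq_sqrt (hq₀.le.trans ht)
      nlinarith
    have h1 : m ≤ √s := Real.sqrt_le_sqrt hs
    have h2 : 0 ≤ √t := Real.sqrt_nonneg _
    rw [le_div_iff₀ hm0, e1, abs_mul]
    refine mul_le_mul_of_nonneg_left ?_ (abs_nonneg _)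
    exact le_trans (by linarith) (le_abs_self _)
  set C : ℝ := K₁ / m / m + √M * (K₂ / m) / (m * m) with hC
  have hC0 : 0 ≤ C := by positivity
  refine ⟨⟨C, hC0⟩, LipschitzOnWith.of_dist_le_mul fun x hx y hy => ?_⟩
  have d1 := h1.dist_le_mul x hx y hy
  have d2 := h2.dist_le_mul x hx y hy
  rw [Real.dist_eq] at d1 d2 ⊢
  have s1 := sl _ _ (hq x hx) (hq y hy)
  have s2 := sl _ _ (hqt x hx) (hqt y hy)
  have bx : m ≤ √(qt x) := Real.sqrt_le_sqrt (hqt x hx)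
  have hby : m ≤ √(qt y) := Real.sqrt_le_sqrt (hqt y hy)
  have ay : √(q y) ≤ √M := Real.sqrt_le_sqrt (hqM y hy)
  have bx0 := hm0.trans_le bx
  have by0 := hm0.trans_le hby
  have e : (1 - √(q x) / √(qt x)) - (1 - √(q y) / √(qt y)) =
      -((√(q x) - √(q y)) / √(qt x)) + √(q y) * (√(qt x) - √(qt y)) / (√(qt x) * √(qt y)) := by
    field_simp
    ring
  rw [e]
  refine (abs_add_le _ _).trans ?_
  rw [abs_neg, abs_div, abs_div, abs_mul, abs_of_pos bx0, abs_of_pos (mul_pos bx0 by0),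
    abs_of_nonneg (Real.sqrt_nonneg (q y))]
  change _ ≤ C * dist x y
  calc _ ≤ (K₁ * dist x y / m) / m + √M * (K₂ * dist x y / m) / (m * m) := by
        gcongr
        · exact s1.trans (by gcongr)
        · exact s2.trans (by gcongr)
    _ = _ := by rw [hC]; ring

lemma cs_integral {α : Type*} [MeasurableSpace α] {μ : Measure α} [IsFiniteMeasure μ] {f : α → ℝ}
    (hf : Integrable f μ) (hf2 : Integrable (fun x => f x ^ 2) μ) :
    (∫ x, f x ∂μ) ^ 2 ≤ μ.real univ * ∫ x, f x ^ 2 ∂μ := by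
  set T := ∫ x, f x ∂μ
  set V := μ.real univ
  have h : ∀ t : ℝ, 0 ≤ (∫ x, f x ^ 2 ∂μ) - 2 * t * T + t ^ 2 * V := by
    intro t
    have h0 : 0 ≤ ∫ x, (f x - t) ^ 2 ∂μ := integral_nonneg fun x => sq_nonneg _
    have e : ∫ x, (f x - t) ^ 2 ∂μ = (∫ x, f x ^ 2 ∂μ) - 2 * t * T + t ^ 2 * V := by
      have : (fun x => (f x - t) ^ 2) = fun x => f x ^ 2 - 2 * t * f x + t ^ 2 := by
        funext x; ring
      have hi : Integrable (fun x => f x ^ 2 - 2 * t * f x) μ := hf2.sub (hf.const_mul _)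
      rw [this, integral_add hi (integrable_const _),
        integral_sub hf2 (hf.const_mul _), integral_const_mul, integral_const, smul_eq_mul]
      ring
    rwa [e] at h0
  have hV : 0 ≤ V := measureReal_nonneg
  rcases hV.eq_or_lt with h0 | h0
  · have : μ = 0 := by
      rw [← Measure.measure_univ_eq_zero]
      exact (measureReal_eq_zero_iff).1 h0.symm
    have : T = 0 := by simp [T, this]
    rw [this, ← h0]; simp
  · have := h (T / V)
    have e : (∫ x, f x ^ 2 ∂μ) - 2 * (T / V) * T + (T / V) ^ 2 * V =
      (∫ x, f x ^ 2 ∂μ) - T ^ 2 / V := by field_simp; ring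
    rw [e] at this
    have h1 : T ^ 2 / V ≤ ∫ x, f x ^ 2 ∂μ := by linarith
    rw [div_le_iff₀ h0] at h1
    linarith

lemma lipNear_abs {n : ℕ} {Ω : Set (EuclideanSpace ℝ (Fin n))} (hΩ : IsOpen Ω)
    {u : EuclideanSpace ℝ (Fin n) → ℝ} (hu : ContDiffOn ℝ 2 u Ω) :
    ∀ᵐ x ∂(volume.restrict Ω), DifferentiableAt ℝ (fun y => |u y|) x := by
  refine ae_diff_of_locally hΩ fun x hx => ?_
  have h1 : ContDiffAt ℝ 1 u x := (hu.contDiffAt (hΩ.mem_nhds hx)).of_le (by norm_num)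
  obtain ⟨K, t, ht, hK⟩ := h1.exists_lipschitzOnWith
  refine ⟨K, t, ht, LipschitzOnWith.of_dist_le_mul fun y hy z hz => ?_⟩
  refine le_trans ?_ (hK.dist_le_mul y hy z hz)
  rw [Real.dist_eq, Real.dist_eq]
  exact abs_abs_sub_abs_le _ _

set_option maxHeartbeats 4000000

theorem stmt_3 {n : ℕ} (hn : n = 2 ∨ n = 3)
    (Ω : Set (EuclideanSpace ℝ (Fin n)))
    (hΩo : IsOpen Ω) (hΩb : Bornology.IsBounded Ω) (hΩc : IsConnected Ω)
    (hΩreg : IsC11Boundary Ω)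
    (A : Fin n → Fin n → EuclideanSpace ℝ (Fin n) → ℝ) (hA : EllipticSym Ω A)
    (q₀ M : ℝ) (hq₀ : 0 < q₀) (hM : 0 < M) :
    ∃ C > 0, ∀ q qt u ut : EuclideanSpace ℝ (Fin n) → ℝ,
      W1InfBound Ω q M → W1InfBound Ω qt M →
      (∀ x ∈ closure Ω, q₀ ≤ q x) → (∀ x ∈ closure Ω, q₀ ≤ qt x) →
      (∀ x ∈ frontier Ω, q x = qt x) →
      ContDiffOn ℝ 2 u Ω → ContDiffOn ℝ 1 u (closure Ω) →
      ContDiffOn ℝ 2 ut Ω → ContDiffOn ℝ 1 ut (closure Ω) →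
      IsSolution A q u Ω → IsSolution A qt ut Ω →
      (∀ x ∈ frontier Ω, u x = ut x) →
      (∀ x ∈ closure Ω, |u x| ≤ M) → (∀ x ∈ Ω, ‖fderiv ℝ u x‖ ≤ M) →
      (∀ x ∈ closure Ω, |ut x| ≤ M) → (∀ x ∈ Ω, ‖fderiv ℝ ut x‖ ≤ M) →
      H1Norm Ω (fun x => Real.sqrt (q x) * |u x| * (q x - qt x)) ≤
        C * (H1Norm Ω
          (fun x => Real.sqrt (q x) * |u x| - Real.sqrt (qt x) * |ut x|)) ^ (1 / 2 : ℝ) := by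

  have hΩm : MeasurableSet Ω := hΩo.measurableSet
  have hsub : Ω ⊆ closure Ω := subset_closure
  obtain ⟨-, hA1, lam, hlam, hell⟩ := hA
  have hA1' : ∀ i j, ContDiffOn ℝ 1 (A i j) Ω := fun i j => (hA1 i j).mono hsub
  have hAb : ∀ i j, ∃ T, ∀ x ∈ closure Ω, ‖A i j x‖ ≤ T := fun i j =>
    hΩb.isCompact_closure.exists_bound_of_continuousOn (hA1 i j).continuousOn
  choose T hT using hAb
  set NA : ℝ := ∑ i, ∑ j, |T i j| with hNA
  have hNA0 : 0 ≤ NA := Finset.sum_nonneg fun i _ => Finset.sum_nonneg fun j _ => abs_nonneg _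
  have hNAb : ∀ i j, ∀ x ∈ Ω, |A i j x| ≤ NA := by
    intro i j x hx
    refine (hT i j x (hsub hx)).trans ((le_abs_self _).trans ?_)
    refine le_trans ?_ (Finset.single_le_sum (f := fun i => ∑ j, |T i j|)
      (fun i _ => Finset.sum_nonneg fun j _ => abs_nonneg _) (Finset.mem_univ i))
    exact Finset.single_le_sum (f := fun j => |T i j|) (fun j _ => abs_nonneg _)
      (Finset.mem_univ j)
  set m : ℝ := √q₀ with hm
  have hm0 : 0 < m := Real.sqrt_pos.2 hq₀
  set N : ℝ := n * n * NA + M + √M + 1 / (2 * m) * M with hN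
  have hN0 : 0 < N := by positivity
  have hN1 : n * n * NA ≤ N := by
    have : 0 ≤ M + √M + 1 / (2 * m) * M := by positivity
    rw [hN]; linarith
  have hN2 : M ≤ N := by
    have : 0 ≤ n * n * NA + √M + 1 / (2 * m) * M := by positivity
    rw [hN]; linarith
  have hN3 : √M ≤ N := by
    have : 0 ≤ n * n * NA + M + 1 / (2 * m) * M := by positivity
    rw [hN]; linarith
  have hN4 : 1 / (2 * m) * M ≤ N := by
    have : 0 ≤ n * n * NA + M + √M := by positivity
    rw [hN]; linarith
  obtain ⟨Ca, Cb, hCa, hCb, hpt⟩ :=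
    pointwise_est (F := EuclideanSpace ℝ (Fin n) →L[ℝ] ℝ) hm0 hN0 hlam
  have : IsFiniteMeasure (volume.restrict Ω) := ⟨by
    rw [Measure.restrict_apply_univ]; exact hΩb.measure_lt_top⟩
  set V : ℝ := (volume.restrict Ω).real univ with hV
  have hV0 : 0 ≤ V := measureReal_nonneg
  set C0 : ℝ := Cb * √(2 * V) with hC0
  have hC00 : 0 ≤ C0 := by positivity
  refine ⟨√C0 + 1, by positivity, ?_⟩
  intro q qt u ut hq hqt hqq₀ hqtq₀ hqqt hu _ hut _ hsu hsut _ huM hduM hutM hdutM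
  obtain ⟨K₁, hK₁, hqM⟩ := hq
  obtain ⟨K₂, hK₂, hqtM⟩ := hqt
  have hK₁0 : (0:ℝ) ≤ K₁ := K₁.coe_nonneg
  have hK₂0 : (0:ℝ) ≤ K₂ := K₂.coe_nonneg
  have hqM' : ∀ x ∈ closure Ω, |q x| ≤ M := fun x hx => by have := hqM x hx; linarith
  have hqtM' : ∀ x ∈ closure Ω, |qt x| ≤ M := fun x hx => by have := hqtM x hx; linarith
  have hqle : ∀ x ∈ closure Ω, q x ≤ M := fun x hx => (le_abs_self _).trans (hqM' x hx)
  have hqtle : ∀ x ∈ closure Ω, qt x ≤ M := fun x hx => (le_abs_self _).trans (hqtM' x hx)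
  obtain ⟨L₁, hL₁⟩ := theta_lip hq₀ hK₁ hK₂ hqq₀ hqtq₀ hqle
  obtain ⟨L₂, hL₂⟩ := theta_lip hq₀ hK₂ hK₁ hqtq₀ hqq₀ hqtle
  have hth1 : ∀ x ∈ frontier Ω, 1 - √(q x) / √(qt x) = 0 := by
    intro x hx
    have : 0 < qt x := hq₀.trans_le (hqtq₀ x (frontier_subset_closure hx))
    rw [hqqt x hx, div_self (Real.sqrt_pos.2 this).ne', sub_self]
  have hth2 : ∀ x ∈ frontier Ω, 1 - √(qt x) / √(q x) = 0 := by
    intro x hx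
    have : 0 < qt x := hq₀.trans_le (hqtq₀ x (frontier_subset_closure hx))
    rw [hqqt x hx, div_self (Real.sqrt_pos.2 this).ne', sub_self]
  have W1 := weak_form hn hΩo hΩb hA1' hNAb hNA0 hM.le hu hsu (fun x hx => huM x (hsub hx)) hduM
    (fun x hx => hqM' x (hsub hx)) hL₁ hth1
  have W2 := weak_form hn hΩo hΩb hA1' hNAb hNA0 hM.le hut hsut (fun x hx => hutM x (hsub hx))
    hdutM (fun x hx => hqtM' x (hsub hx)) hL₂ hth2
  set I₁ : EuclideanSpace ℝ (Fin n) → ℝ := fun x => (1 - √(q x) / √(qt x)) *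
    bil A x (fderiv ℝ u x) (fderiv ℝ u x)
      + u x * bil A x (fderiv ℝ u x) (fderiv ℝ (fun x => 1 - √(q x) / √(qt x)) x)
      - q x * (u x) ^ 2 * (1 - √(q x) / √(qt x)) with hI₁
  set I₂ : EuclideanSpace ℝ (Fin n) → ℝ := fun x => (1 - √(qt x) / √(q x)) *
    bil A x (fderiv ℝ ut x) (fderiv ℝ ut x)
      + ut x * bil A x (fderiv ℝ ut x) (fderiv ℝ (fun x => 1 - √(qt x) / √(q x)) x)
      - qt x * (ut x) ^ 2 * (1 - √(qt x) / √(q x)) with hI₂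
  set v : EuclideanSpace ℝ (Fin n) → ℝ := fun x => √(q x) * |u x| * (q x - qt x) with hv
  set d : EuclideanSpace ℝ (Fin n) → ℝ := fun x => √(q x) * |u x| - √(qt x) * |ut x| with hd
  -- the pointwise estimate
  have hlipd : ∀ (f : EuclideanSpace ℝ (Fin n) → ℝ) (K : NNReal),
      LipschitzOnWith K f (closure Ω) →
      ∀ᵐ x ∂(volume.restrict Ω), DifferentiableAt ℝ f x := fun f K hf =>
    ae_diff_of_locally hΩo fun x hx => ⟨K, Ω, hΩo.mem_nhds hx, hf.mono hsub⟩
  have hae : ∀ᵐ x ∂(volume.restrict Ω), |d x| + ‖fderiv ℝ d x‖ ≤ 6 * N ^ 2 ∧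
      v x ^ 2 + ‖fderiv ℝ v x‖ ^ 2 ≤ Ca * (I₁ x + I₂ x) + Cb * (|d x| + ‖fderiv ℝ d x‖) := by
    filter_upwards [lipNear_abs hΩo hu, lipNear_abs hΩo hut, hlipd q K₁ hK₁, hlipd qt K₂ hK₂,
      ae_restrict_mem hΩm] with x hux hutx hqx hqtx hx
    have hxc := hsub hx
    have hnx := hΩo.mem_nhds hx
    have hqp : 0 < q x := hq₀.trans_le (hqq₀ x hxc)
    have hqtp : 0 < qt x := hq₀.trans_le (hqtq₀ x hxc)
    have hud : DifferentiableAt ℝ u x := (hu.contDiffAt hnx).differentiableAt (by norm_num)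
    have hutd : DifferentiableAt ℝ ut x := (hut.contDiffAt hnx).differentiableAt (by norm_num)
    obtain ⟨s, hs1, hs2, hs3⟩ := fderiv_abs_cases hud hux
    obtain ⟨t, ht1, ht2, ht3⟩ := fderiv_abs_cases hutd hutx
    have hs' : |s| = 1 := by
      rcases mul_self_eq_one_iff.1 hs1 with h | h <;> simp [h]
    have ht' : |t| = 1 := by
      rcases mul_self_eq_one_iff.1 ht1 with h | h <;> simp [h]
    set P := fderiv ℝ (fun y => |u y|) x with hP
    set Pt := fderiv ℝ (fun y => |ut y|) x with hPt
    obtain ⟨f1, f2, f3⟩ := fderiv_formulas (w := fun y => |u y|) (wt := fun y => |ut y|)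
      hqx.hasFDerivAt hqtx.hasFDerivAt
      hux.hasFDerivAt hutx.hasFDerivAt hqp hqtp rfl rfl rfl rfl
    obtain ⟨-, -, f4⟩ := fderiv_formulas (w := fun y => |ut y|) (wt := fun y => |u y|)
      hqtx.hasFDerivAt hqx.hasFDerivAt
      hutx.hasFDerivAt hux.hasFDerivAt hqtp hqp rfl rfl rfl rfl
    set a := √(q x) with ha
    set b := √(qt x) with hb
    set a' := (1 / (2 * a)) • fderiv ℝ q x with ha'
    set b' := (1 / (2 * b)) • fderiv ℝ qt x with hb'
    have hma : m ≤ a := Real.sqrt_le_sqrt (hqq₀ x hxc)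
    have hmb : m ≤ b := Real.sqrt_le_sqrt (hqtq₀ x hxc)
    have haN : a ≤ N := (Real.sqrt_le_sqrt (hqle x hxc)).trans hN3
    have hbN : b ≤ N := (Real.sqrt_le_sqrt (hqtle x hxc)).trans hN3
    have ha0 : 0 < a := hm0.trans_le hma
    have hb0 : 0 < b := hm0.trans_le hmb
    have hdq : ‖fderiv ℝ q x‖ ≤ M := by
      have h1 := norm_fderiv_le_of_lipschitzOn ℝ hnx (hK₁.mono hsub)
      have h2 := hqM x hxc
      have h3 := abs_nonneg (q x)
      linarith
    have hdqt : ‖fderiv ℝ qt x‖ ≤ M := by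
      have h1 := norm_fderiv_le_of_lipschitzOn ℝ hnx (hK₂.mono hsub)
      have h2 := hqtM x hxc
      have h3 := abs_nonneg (qt x)
      linarith
    have ha'N : ‖a'‖ ≤ N := by
      refine le_trans ?_ hN4
      rw [ha', norm_smul, Real.norm_of_nonneg (by positivity)]
      gcongr
    have hb'N : ‖b'‖ ≤ N := by
      refine le_trans ?_ hN4
      rw [hb', norm_smul, Real.norm_of_nonneg (by positivity)]
      gcongr
    have hPN : ‖P‖ ≤ N := by
      rw [hs3, norm_smul, Real.norm_eq_abs, hs', one_mul]
      exact (hduM x hx).trans hN2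
    have hPtN : ‖Pt‖ ≤ N := by
      rw [ht3, norm_smul, Real.norm_eq_abs, ht', one_mul]
      exact (hdutM x hx).trans hN2
    have hB : ∀ p r, |bil A x p r| ≤ N * ‖p‖ * ‖r‖ := fun p r =>
      (bil_bound (fun i j => hNAb i j x hx) p r).trans (by gcongr)
    have key := hpt (bil A x) a b |u x| |ut x| P Pt a' b' hB (bil_coercive (hell x hx))
      hma hmb haN hbN (abs_nonneg _) ((huM x hxc).trans hN2) (abs_nonneg _)
      ((hutM x hxc).trans hN2) hPN hPtN ha'N hb'N
    have hqa : q x = a ^ 2 := by rw [ha, Real.sq_sqrt hqp.le]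
    have hqb : qt x = b ^ 2 := by rw [hb, Real.sq_sqrt hqtp.le]
    have hdx : d x = a * |u x| - b * |ut x| := rfl
    have hvx : v x = a * |u x| * (a ^ 2 - b ^ 2) := by rw [← hqa, ← hqb]
    have hI₁x : I₁ x = (1 - a / b) * bil A x P P +
        |u x| * bil A x P (-(1 / b) • a' + (a / b ^ 2) • b') - a ^ 2 * |u x| ^ 2 * (1 - a / b) := by
      have e1 : bil A x P P = bil A x (fderiv ℝ u x) (fderiv ℝ u x) := by
        rw [hs3]
        simp only [map_smul, LinearMap.smul_apply, smul_eq_mul]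
        linear_combination (bil A x (fderiv ℝ u x) (fderiv ℝ u x)) * hs1
      have e2 : ∀ r, |u x| * bil A x P r = u x * bil A x (fderiv ℝ u x) r := by
        intro r
        rw [hs3, hs2]
        simp only [map_smul, LinearMap.smul_apply, smul_eq_mul]
        linear_combination (u x * bil A x (fderiv ℝ u x) r) * hs1
      rw [e1, e2, sq_abs, ← hqa, ← f3]
    have hI₂x : I₂ x = (1 - b / a) * bil A x Pt Pt +
        |ut x| * bil A x Pt (-(1 / a) • b' + (b / a ^ 2) • a')
          - b ^ 2 * |ut x| ^ 2 * (1 - b / a) := by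
      have e1 : bil A x Pt Pt = bil A x (fderiv ℝ ut x) (fderiv ℝ ut x) := by
        rw [ht3]
        simp only [map_smul, LinearMap.smul_apply, smul_eq_mul]
        linear_combination (bil A x (fderiv ℝ ut x) (fderiv ℝ ut x)) * ht1
      have e2 : ∀ r, |ut x| * bil A x Pt r = ut x * bil A x (fderiv ℝ ut x) r := by
        intro r
        rw [ht3, ht2]
        simp only [map_smul, LinearMap.smul_apply, smul_eq_mul]
        linear_combination (ut x * bil A x (fderiv ℝ ut x) r) * ht1
      rw [e1, e2, sq_abs, ← hqb, ← f4]
    have hfv : fderiv ℝ v x = (a ^ 2 - b ^ 2) • (|u x| • a' + a • P)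
      + (a * |u x|) • ((2 * a) • a' - (2 * b) • b') := f1
    have hfd : fderiv ℝ d x = (|u x| • a' + a • P) - (|ut x| • b' + b • Pt) := f2
    rw [hI₁x, hI₂x, hfv, hfd, hdx, hvx]
    exact key
  -- measurability and integrability
  have hdc : ContinuousOn d Ω :=
    (((hK₁.continuousOn.mono hsub).sqrt).mul hu.continuousOn.abs).sub
      (((hK₂.continuousOn.mono hsub).sqrt).mul hut.continuousOn.abs)
  have hdm : AEStronglyMeasurable d (volume.restrict Ω) := hdc.aestronglyMeasurable hΩm
  have hfdm : AEStronglyMeasurable (fun x => ‖fderiv ℝ d x‖) (volume.restrict Ω) :=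
    (measurable_fderiv ℝ d).norm.aestronglyMeasurable
  set X : EuclideanSpace ℝ (Fin n) → ℝ := fun x => |d x| + ‖fderiv ℝ d x‖ with hX
  have hX0 : ∀ x, 0 ≤ X x := fun x => by positivity
  have hXm : AEStronglyMeasurable X (volume.restrict Ω) := hdm.norm.add hfdm
  have hXi : Integrable X (volume.restrict Ω) := by
    refine (integrable_const (6 * N ^ 2)).mono' hXm ?_
    filter_upwards [hae] with x hx
    rw [Real.norm_of_nonneg (hX0 x)]; exact hx.1
  have hX2i : Integrable (fun x => X x ^ 2) (volume.restrict Ω) := by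
    refine (integrable_const ((6 * N ^ 2) ^ 2)).mono' (hXm.pow 2) ?_
    filter_upwards [hae] with x hx
    rw [Real.norm_of_nonneg (by positivity)]
    exact pow_le_pow_left₀ (hX0 x) hx.1 2
  have hSi : Integrable (fun x => d x ^ 2 + ‖fderiv ℝ d x‖ ^ 2) (volume.restrict Ω) := by
    refine hX2i.mono' ((hdm.pow 2).add (hfdm.pow 2)) (Filter.Eventually.of_forall fun x => ?_)
    rw [Real.norm_of_nonneg (by positivity), hX, ← sq_abs (d x)]
    have := mul_nonneg (abs_nonneg (d x)) (norm_nonneg (fderiv ℝ d x))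
    simp only
    nlinarith
  set S : ℝ := ∫ x in Ω, (d x ^ 2 + ‖fderiv ℝ d x‖ ^ 2) with hS
  have hS0 : 0 ≤ S := integral_nonneg fun x => by positivity
  have hXS : ∫ x in Ω, X x ≤ √(2 * V) * √S := by
    rw [← Real.sqrt_mul (by positivity)]
    apply Real.le_sqrt_of_sq_le
    refine (cs_integral hXi hX2i).trans ?_
    have : ∫ x in Ω, X x ^ 2 ≤ 2 * S := by
      rw [hS, ← integral_const_mul]
      refine integral_mono hX2i (hSi.const_mul 2) fun x => ?_
      simp only [hX]
      rw [← sq_abs (d x)]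
      nlinarith [sq_nonneg (|d x| - ‖fderiv ℝ d x‖)]
    calc V * ∫ x in Ω, X x ^ 2 ≤ V * (2 * S) := by gcongr
      _ = _ := by ring
  set W : ℝ := ∫ x in Ω, (v x ^ 2 + ‖fderiv ℝ v x‖ ^ 2) with hW
  have hW0 : 0 ≤ W := integral_nonneg fun x => by positivity
  have hWS : W ≤ C0 * √S := by
    have hI : Integrable (fun x => I₁ x + I₂ x) (volume.restrict Ω) := W1.1.add W2.1
    have hR : Integrable (fun x => Ca * (I₁ x + I₂ x) + Cb * X x) (volume.restrict Ω) :=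
      (hI.const_mul Ca).add (hXi.const_mul Cb)
    have h1 : W ≤ ∫ x in Ω, (Ca * (I₁ x + I₂ x) + Cb * X x) := by
      refine integral_mono_of_nonneg (Filter.Eventually.of_forall fun x => ?_) hR
        (hae.mono fun x hx => hx.2)
      show 0 ≤ v x ^ 2 + ‖fderiv ℝ v x‖ ^ 2
      positivity
    have h2 : ∫ x in Ω, (Ca * (I₁ x + I₂ x) + Cb * X x) = Cb * ∫ x in Ω, X x := by
      rw [integral_add (hI.const_mul Ca) (hXi.const_mul Cb), integral_const_mul,
        integral_const_mul, integral_add W1.1 W2.1, W1.2, W2.2]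
      simp
    rw [h2] at h1
    refine h1.trans ?_
    rw [hC0, mul_assoc]
    gcongr
  show W ^ (1 / 2 : ℝ) ≤ (√C0 + 1) * (S ^ (1 / 2 : ℝ)) ^ (1 / 2 : ℝ)
  rw [← Real.sqrt_eq_rpow, ← Real.sqrt_eq_rpow, ← Real.sqrt_eq_rpow]
  calc √W ≤ √(C0 * √S) := Real.sqrt_le_sqrt hWS
    _ = √C0 * √(√S) := Real.sqrt_mul hC00 _
    _ ≤ (√C0 + 1) * √(√S) := by
      gcongr
      linarith
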